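/- For integers p, n ≥ 1 and a real number s with s > −2, the integral over the matrix ball {Z ∈ M_{n×p}(ℝ) : ᵀZ·Z < 1_p} of det(1_p − ᵀZ·Z)^{s/2} with respect to Lebesgue measure on M_{n×p}(ℝ) ≅ ℝ^{np} equals π^{np/2} · ∏_{i=1}^{n} Γ((s+i+1)/2) / Γ((s+p+i+1)/2). -/

import Mathlib

open MeasureTheory Matrix

open scoped ENNReal MatrixOrder

section HuaIntegral

variable {ι : Type*} [Fintype ι] [DecidableEq ι]

/-- The function `A ↦ (det A)^{s/2}` on positive definite matrices, extended by zero. -/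
noncomputable def posDefDetPow (s : ℝ) : Matrix ι ι ℝ → ℝ≥0∞ :=
  {A | A.PosDef}.indicator fun A => ENNReal.ofReal (A.det ^ (s / 2))

theorem posDefDetPow_of_posDef (s : ℝ) {A : Matrix ι ι ℝ} (hA : A.PosDef) :
    posDefDetPow s A = ENNReal.ofReal (A.det ^ (s / 2)) :=
  Set.indicator_of_mem (s := {A : Matrix ι ι ℝ | A.PosDef}) hA _

theorem posDefDetPow_of_not_posDef (s : ℝ) {A : Matrix ι ι ℝ} (hA : ¬ A.PosDef) :
    posDefDetPow s A = 0 :=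
  Set.indicator_of_notMem (s := {A : Matrix ι ι ℝ | A.PosDef}) hA _

/-- The value of `∫ (1 - |y|²)^{s/2} dy` over the unit ball of `ℝᵖ`. -/
noncomputable def ballBeta (p : ℕ) (s : ℝ) : ℝ :=
  Real.pi ^ ((p : ℝ) / 2) * (Real.Gamma ((s + 2) / 2) / Real.Gamma ((s + p + 2) / 2))

theorem ballBeta_pos (p : ℕ) {s : ℝ} (hs : -2 < s) : 0 < ballBeta p s := by
  have hp : (0 : ℝ) ≤ p := p.cast_nonneg
  exact mul_pos (by positivity) (div_pos (Real.Gamma_pos_of_pos (by linarith))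
    (Real.Gamma_pos_of_pos (by linarith)))

theorem measurableSet_posDef_comp {X : Type*} [TopologicalSpace X] [MeasurableSpace X]
    [OpensMeasurableSpace X] {M : X → Matrix ι ι ℝ} (hM : Continuous M) :
    MeasurableSet {x | (M x).PosDef} := by
  have h : {x | (M x).PosDef} = {x | (M x).PosSemidef} ∩ {x | (M x).det ≠ 0} := by
    ext x
    exact ⟨fun h => ⟨h.posSemidef, h.det_pos.ne'⟩, fun h => h.1.posDef_iff_det_ne_zero.2 h.2⟩
  rw [h]
  refine MeasurableSet.inter (IsClosed.measurableSet ?_) (IsOpen.measurableSet ?_)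
  · simp only [posSemidef_iff_dotProduct_mulVec, IsHermitian, Set.ofPred_and, Set.ofPred_forall]
    refine (isClosed_eq (by fun_prop) hM).inter (isClosed_iInter fun v => ?_)
    exact isClosed_le continuous_const (by fun_prop)
  · exact isOpen_ne_fun (by fun_prop) continuous_const

theorem measurable_posDefDetPow_comp {X : Type*} [TopologicalSpace X] [MeasurableSpace X]
    [OpensMeasurableSpace X] (s : ℝ) {M : X → Matrix ι ι ℝ} (hM : Continuous M) :
    Measurable fun x => posDefDetPow s (M x) := by
  have hdet : Measurable fun x => (M x).det := (show Continuous _ by fun_prop).measurable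
  exact Measurable.indicator (s := {x | (M x).PosDef})
    (f := fun x => ENNReal.ofReal ((M x).det ^ (s / 2)))
    (by fun_prop) (measurableSet_posDef_comp hM)

theorem det_one_sub_vecMulVec_self (x : ι → ℝ) :
    (1 - vecMulVec x x : Matrix ι ι ℝ).det = 1 - x ⬝ᵥ x := by
  rw [vecMulVec_eq Unit, det_one_sub_mul_comm, det_unique, Matrix.sub_apply,
    Matrix.replicateRow_mul_replicateCol_apply, Matrix.one_apply_eq]

theorem posDef_one_sub_vecMulVec_self_iff (x : ι → ℝ) :
    (1 - vecMulVec x x : Matrix ι ι ℝ).PosDef ↔ x ⬝ᵥ x < 1 := by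
  refine ⟨fun h => ?_, fun h => ?_⟩
  · have := h.det_pos
    rw [det_one_sub_vecMulVec_self] at this
    linarith
  · refine .of_dotProduct_mulVec_pos ?_ fun v hv => ?_
    · ext i j
      simp [vecMulVec_apply, Matrix.one_apply, mul_comm, eq_comm]
    · have hcs : (v ⬝ᵥ x) ^ 2 ≤ (v ⬝ᵥ v) * (x ⬝ᵥ x) := by
        simpa [dotProduct, sq] using
          Finset.sum_mul_sq_le_sq_mul_sq Finset.univ v x
      have hv' : 0 < v ⬝ᵥ v := by simpa using dotProduct_star_self_pos_iff.2 hv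
      have : star v ⬝ᵥ ((1 - vecMulVec x x) *ᵥ v) = v ⬝ᵥ v - (v ⬝ᵥ x) ^ 2 := by
        simp [sub_mulVec, vecMulVec_mulVec, dotProduct_sub, dotProduct_comm x v, sq]
      rw [this]
      nlinarith

theorem posDefDetPow_one_sub_vecMulVec_self (s : ℝ) (x : ι → ℝ) :
    posDefDetPow s (1 - vecMulVec x x) =
      ENNReal.ofReal (if x ⬝ᵥ x < 1 then (1 - x ⬝ᵥ x) ^ (s / 2) else 0) := by
  by_cases h : x ⬝ᵥ x < 1
  · simp [posDefDetPow, posDef_one_sub_vecMulVec_self_iff, det_one_sub_vecMulVec_self, h]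
  · simp [posDefDetPow, posDef_one_sub_vecMulVec_self_iff, h]

theorem posDefDetPow_conj (s : ℝ) {B : Matrix ι ι ℝ} (hB : B.det ≠ 0) (M : Matrix ι ι ℝ) :
    posDefDetPow s (Bᵀ * M * B) = ENNReal.ofReal (|B.det| ^ s) * posDefDetPow s M := by
  have hU : IsUnit B := (isUnit_iff_isUnit_det B).2 hB.isUnit
  have hiff : (Bᵀ * M * B).PosDef ↔ M.PosDef := by
    simpa [star_eq_conjTranspose] using hU.posDef_star_left_conjugate_iff (x := M)
  by_cases h : M.PosDef
  · rw [posDefDetPow_of_posDef s (hiff.2 h), posDefDetPow_of_posDef s h,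
      ← ENNReal.ofReal_mul (by positivity)]
    congr 1
    rw [show (Bᵀ * M * B).det = |B.det| ^ (2 : ℝ) * M.det by
        rw [det_mul, det_mul, det_transpose, Real.rpow_two, sq_abs]; ring,
      Real.mul_rpow (by positivity) h.det_pos.le, ← Real.rpow_mul (abs_nonneg _)]
    congr 2
    ring
  · rw [posDefDetPow_of_not_posDef s (mt hiff.1 h), posDefDetPow_of_not_posDef s h, mul_zero]

theorem lintegral_comp_mulVec {B : Matrix ι ι ℝ} (hB : B.det ≠ 0) {f : (ι → ℝ) → ℝ≥0∞}
    (hf : Measurable f) :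
    ∫⁻ x, f x = ENNReal.ofReal |B.det| * ∫⁻ y, f (B *ᵥ y) := by
  have hmap : ∫⁻ y, f (B *ᵥ y) = ENNReal.ofReal |B.det⁻¹| * ∫⁻ x, f x := by
    have hcont : Continuous (toLin' B) := LinearMap.continuous_of_finiteDimensional _
    have := lintegral_map (μ := volume) hf hcont.measurable
    rw [Real.map_matrix_volume_pi_eq_smul_volume_pi hB, lintegral_smul_measure] at this
    simpa using this.symm
  rw [hmap, ← mul_assoc, ← ENNReal.ofReal_mul (abs_nonneg _), ← abs_mul, mul_inv_cancel₀ hB]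
  simp

theorem lintegral_posDefDetPow_sub_vecMulVec (s : ℝ) (A : Matrix ι ι ℝ) :
    ∫⁻ x, posDefDetPow s (A - vecMulVec x x) =
      posDefDetPow (s + 1) A * ∫⁻ y : ι → ℝ, posDefDetPow s (1 - vecMulVec y y) := by
  have hmeas (M : Matrix ι ι ℝ) : Measurable fun x => posDefDetPow s (M - vecMulVec x x) :=
    measurable_posDefDetPow_comp s (by fun_prop)
  by_cases hA : A.PosDef
  · obtain ⟨B, rfl⟩ := CStarAlgebra.nonneg_iff_eq_star_mul_self.mp hA.posSemidef.nonneg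
    have hstar : star B = Bᵀ := by simp [star_eq_conjTranspose]
    rw [hstar] at hA ⊢
    have hB : B.det ≠ 0 := fun h => hA.det_pos.ne' (by simp [h])
    have hsub (y : ι → ℝ) : Bᵀ * B - vecMulVec (Bᵀ *ᵥ y) (Bᵀ *ᵥ y) =
        Bᵀ * (1 - vecMulVec y y) * B := by
      rw [Matrix.mul_sub, Matrix.sub_mul, Matrix.mul_one, mul_vecMulVec, vecMulVec_mul,
        mulVec_transpose]
    have hA' : posDefDetPow (s + 1) (Bᵀ * B) = ENNReal.ofReal (|B.det| ^ (s + 1)) := by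
      simpa [posDefDetPow_of_posDef _ PosDef.one] using posDefDetPow_conj (s + 1) hB 1
    rw [lintegral_comp_mulVec (B := Bᵀ) (by simpa using hB) (hmeas _)]
    simp_rw [hsub, posDefDetPow_conj s hB]
    rw [lintegral_const_mul _ (hmeas 1), ← mul_assoc, det_transpose,
      ← ENNReal.ofReal_mul (abs_nonneg _), hA', Real.rpow_add (abs_pos.2 hB), Real.rpow_one,
      mul_comm |B.det|]
  · have h (x : ι → ℝ) : ¬ (A - vecMulVec x x).PosDef := fun h => hA <| by
      simpa using h.add_posSemidef (posSemidef_vecMulVec_self_star x)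
    simp [posDefDetPow, hA, h]

end HuaIntegral

theorem integral_Ioi_pow_mul_one_sub_sq_rpow {p : ℕ} (hp : 1 ≤ p) {s : ℝ} (hs : -2 < s) :
    ∫ r in Set.Ioi (0 : ℝ), r ^ (p - 1) • (if r ^ 2 < 1 then (1 - r ^ 2) ^ (s / 2) else 0) =
      ProbabilityTheory.beta (p / 2) (s / 2 + 1) / 2 := by
  have hp' : (0 : ℝ) < p / 2 := by positivity
  have hs' : 0 < s / 2 + 1 := by linarith
  have hβ := ProbabilityTheory.beta_pos hp' hs'
  have hnn (x : ℝ) : 0 ≤ ProbabilityTheory.betaPDFReal (p / 2) (s / 2 + 1) x := by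
    by_cases h : 0 < x ∧ x < 1
    · exact (ProbabilityTheory.betaPDFReal_pos h.1 h.2 hp' hs').le
    · simp [ProbabilityTheory.betaPDFReal, h]
  have htotal : ∫ x in Set.Ioi (0 : ℝ),
      ProbabilityTheory.betaPDFReal (p / 2) (s / 2 + 1) x = 1 := by
    rw [setIntegral_eq_integral_of_forall_compl_eq_zero fun x hx => by
        simp [ProbabilityTheory.betaPDFReal, show ¬ 0 < x from hx],
      integral_eq_lintegral_of_nonneg_ae (.of_forall hnn)
        (ProbabilityTheory.stronglyMeasurable_betaPDFReal _ _).aestronglyMeasurable]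
    have := ProbabilityTheory.lintegral_betaPDF_eq_one hp' hs'
    simp only [ProbabilityTheory.betaPDF] at this
    simp [this]
  rw [← integral_comp_rpow_Ioi_of_pos (zero_lt_two' ℝ)] at htotal
  have hcongr : ∫ r in Set.Ioi (0 : ℝ),
        r ^ (p - 1) • (if r ^ 2 < 1 then (1 - r ^ 2) ^ (s / 2) else 0) =
      ∫ r in Set.Ioi (0 : ℝ), (ProbabilityTheory.beta (p / 2) (s / 2 + 1) / 2) *
        ((2 * r ^ ((2 : ℝ) - 1)) •
          ProbabilityTheory.betaPDFReal (p / 2) (s / 2 + 1) (r ^ (2 : ℝ))) := by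
    refine setIntegral_congr_fun measurableSet_Ioi fun r (hr : 0 < r) => ?_
    have h2 : 0 < r ^ 2 := by positivity
    have hpow : r ^ ((2 : ℝ) - 1) * (r ^ 2) ^ ((p : ℝ) / 2 - 1) = r ^ (p - 1) := by
      rw [← Real.rpow_natCast r 2, ← Real.rpow_mul hr.le, ← Real.rpow_add hr,
        ← Real.rpow_natCast r (p - 1)]
      congr 1
      push_cast [hp]
      ring
    simp only [ProbabilityTheory.betaPDFReal, Real.rpow_two, h2, true_and, smul_eq_mul]
    split_ifs with h
    · rw [← hpow, add_sub_cancel_right]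
      generalize ProbabilityTheory.beta (p / 2) (s / 2 + 1) = b at hβ
      field_simp
    · simp
  rw [hcongr, integral_const_mul, htotal, mul_one]

theorem integral_euclidean_one_sub_norm_sq_rpow {p : ℕ} (hp : 1 ≤ p) {s : ℝ} (hs : -2 < s) :
    ∫ x : EuclideanSpace ℝ (Fin p), (if ‖x‖ ^ 2 < 1 then (1 - ‖x‖ ^ 2) ^ (s / 2) else 0) =
      ballBeta p s := by
  have : Nonempty (Fin p) := ⟨⟨0, hp⟩⟩
  have hp0 : (0 : ℝ) < p / 2 := by positivity
  have hΓ : 0 < Real.Gamma (p / 2) := Real.Gamma_pos_of_pos hp0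
  rw [integral_fun_norm_addHaar (μ := volume)
    (fun r => if r ^ 2 < 1 then (1 - r ^ 2) ^ (s / 2) else (0 : ℝ)), finrank_euclideanSpace_fin,
    integral_Ioi_pow_mul_one_sub_sq_rpow hp hs, Measure.real, EuclideanSpace.volume_ball,
    ENNReal.ofReal_one, one_pow, one_mul, Fintype.card_fin, Real.Gamma_add_one hp0.ne',
    ENNReal.toReal_ofReal (by positivity), ballBeta, ProbabilityTheory.beta,
    Real.sqrt_eq_rpow, ← Real.rpow_mul_natCast Real.pi_pos.le,
    show (s + 2) / 2 = s / 2 + 1 by ring, show (s + p + 2) / 2 = p / 2 + (s / 2 + 1) by ring,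
    show 1 / 2 * (p : ℝ) = p / 2 by ring]
  simp only [nsmul_eq_mul, smul_eq_mul]
  field_simp

theorem lintegral_posDefDetPow_one_sub_vecMulVec {p : ℕ} (hp : 1 ≤ p) {s : ℝ} (hs : -2 < s) :
    ∫⁻ y : Fin p → ℝ, posDefDetPow s (1 - vecMulVec y y) = ENNReal.ofReal (ballBeta p s) := by
  have hI := integral_euclidean_one_sub_norm_sq_rpow hp hs
  have hint := Integrable.of_integral_ne_zero (hI.trans_ne (ballBeta_pos p hs).ne')
  rw [← hI, ofReal_integral_eq_lintegral_ofReal hint (.of_forall fun x => ?_),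
    ← (PiLp.volume_preserving_ofLp (Fin p)).lintegral_comp
      (measurable_posDefDetPow_comp s (by fun_prop))]
  · refine lintegral_congr fun x => ?_
    have : x.ofLp ⬝ᵥ x.ofLp = ‖x‖ ^ 2 := by
      rw [EuclideanSpace.norm_sq_eq]
      simp [dotProduct, sq]
    rw [posDefDetPow_one_sub_vecMulVec_self, this]
  · dsimp only [Pi.zero_apply]
    split_ifs with h
    · exact Real.rpow_nonneg (by linarith) _
    · rfl

theorem transpose_mul_self_succ {n p : ℕ} (f : Fin (n + 1) → Fin p → ℝ) :
    (Matrix.of f)ᵀ * Matrix.of f =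
      (Matrix.of (Fin.tail f))ᵀ * Matrix.of (Fin.tail f) + vecMulVec (f 0) (f 0) := by
  ext i j
  simp [Matrix.mul_apply, Fin.sum_univ_succ, vecMulVec_apply, Fin.tail, add_comm]

theorem lintegral_posDefDetPow_one_sub_transpose_mul_self {p : ℕ} (hp : 1 ≤ p) (n : ℕ) {s : ℝ}
    (hs : -2 < s) :
    ∫⁻ f : Fin n → Fin p → ℝ, posDefDetPow s (1 - (Matrix.of f)ᵀ * Matrix.of f) =
      ENNReal.ofReal (∏ i ∈ Finset.range n, ballBeta p (s + i)) := by
  induction n generalizing s with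
  | zero =>
    simp [posDefDetPow_of_posDef _ PosDef.one, volume_pi]
  | succ n ih =>
    have hsplit := (volume_preserving_piFinSuccAbove (fun _ : Fin (n + 1) => Fin p → ℝ) 0)
    have hcont : Continuous fun z : (Fin p → ℝ) × (Fin n → Fin p → ℝ) =>
        (1 - (Matrix.of z.2)ᵀ * Matrix.of z.2) - vecMulVec z.1 z.1 := by
      have hof : Continuous fun z : (Fin p → ℝ) × (Fin n → Fin p → ℝ) => Matrix.of z.2 :=
        continuous_snd
      fun_prop
    have hmeas : Measurable fun z : (Fin p → ℝ) × (Fin n → Fin p → ℝ) =>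
        posDefDetPow s ((1 - (Matrix.of z.2)ᵀ * Matrix.of z.2) - vecMulVec z.1 z.1) :=
      measurable_posDefDetPow_comp s hcont
    calc
      _ = ∫⁻ z : (Fin p → ℝ) × (Fin n → Fin p → ℝ),
          posDefDetPow s ((1 - (Matrix.of z.2)ᵀ * Matrix.of z.2) - vecMulVec z.1 z.1) := by
        rw [← hsplit.lintegral_comp hmeas]
        refine lintegral_congr fun f => ?_
        rw [transpose_mul_self_succ, ← sub_sub]
        rfl
      _ = ∫⁻ f : Fin n → Fin p → ℝ, posDefDetPow (s + 1) (1 - (Matrix.of f)ᵀ * Matrix.of f) *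
          ENNReal.ofReal (ballBeta p s) := by
        rw [Measure.volume_eq_prod, lintegral_prod_symm' _ hmeas]
        refine lintegral_congr fun f => ?_
        dsimp only
        rw [lintegral_posDefDetPow_sub_vecMulVec, lintegral_posDefDetPow_one_sub_vecMulVec hp hs]
      _ = _ := by
        rw [lintegral_mul_const' _ _ ENNReal.ofReal_ne_top, ih (by linarith),
          ← ENNReal.ofReal_mul' (ballBeta_pos p hs).le, Finset.prod_range_succ']
        simp only [Nat.cast_add, Nat.cast_one, Nat.cast_zero, add_zero, add_assoc, add_comm (1 : ℝ)]

theorem prod_range_ballBeta (p n : ℕ) (s : ℝ) :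
    ∏ i ∈ Finset.range n, ballBeta p (s + i) = Real.pi ^ ((n * p : ℝ) / 2) *
      ∏ i ∈ Finset.Icc 1 n,
        Real.Gamma ((s + i + 1) / 2) / Real.Gamma ((s + p + i + 1) / 2) := by
  simp only [ballBeta]
  rw [Finset.prod_mul_distrib, Finset.prod_const, Finset.card_range,
    ← Real.rpow_mul_natCast Real.pi_pos.le, ← Finset.Ico_succ_right_eq_Icc,
    Finset.prod_Ico_eq_prod_range]
  congr 1
  · congr 1
    ring
  · refine Finset.prod_congr (by simp) fun i _ => ?_
    push_cast
    congr 2 <;> ring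

/-- Hua-type integral: for `s > −2`,
`∫_{ᵀZZ < 1ₚ} det(1ₚ − ᵀZZ)^{s/2} dZ = π^{np/2} ∏_{i=1}^n Γ((s+i+1)/2)/Γ((s+p+i+1)/2)`,
the integral being over `n × p` real matrices with Lebesgue measure. -/
theorem stmt_9 (p n : ℕ) (hp : 1 ≤ p) (hn : 1 ≤ n) (s : ℝ) (hs : -2 < s) :
    ∫ f : Fin n → Fin p → ℝ in
        {f | ((1 : Matrix (Fin p) (Fin p) ℝ) - (Matrix.of f)ᵀ * Matrix.of f).PosDef},
        ((1 : Matrix (Fin p) (Fin p) ℝ) - (Matrix.of f)ᵀ * Matrix.of f).det ^ (s / 2) =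
      Real.pi ^ ((n * p : ℝ) / 2) *
        ∏ i ∈ Finset.Icc 1 n,
          Real.Gamma ((s + i + 1) / 2) / Real.Gamma ((s + p + i + 1) / 2) := by
  have hM : Continuous fun f : Fin n → Fin p → ℝ =>
      (1 : Matrix (Fin p) (Fin p) ℝ) - (Matrix.of f)ᵀ * Matrix.of f :=
    continuous_const.sub (.matrix_mul (.matrix_transpose continuous_id) continuous_id)
  have hset := measurableSet_posDef_comp hM
  rw [← prod_range_ballBeta, integral_eq_lintegral_of_nonneg_ae
      ((ae_restrict_mem hset).mono fun f hf => Real.rpow_nonneg (PosDef.det_pos hf).le _)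
      (hM.matrix_det.measurable.pow_const _).aestronglyMeasurable,
    ← lintegral_indicator hset]
  refine (congrArg ENNReal.toReal
    (lintegral_posDefDetPow_one_sub_transpose_mul_self hp n hs)).trans
    (ENNReal.toReal_ofReal (Finset.prod_nonneg fun i _ => (ballBeta_pos p ?_).le))
  have : (0 : ℝ) ≤ i := i.cast_nonneg
  linarith
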